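/- arXiv:1310.7178 — 2 statements merged into one kernel-verified Lean document; each statement's English description precedes it below -/
import Mathlib

section
/- Let ρ and σ be d×d positive definite complex matrices with ρ ≤ σ, let 0 < α < 1 and z ≥ 1 − α. Then f_{α,z}(ρ||σ) ≥ Tr ρ, i.e. Tr((ρ^{α/(2z)} σ^{(1−α)/z} ρ^{α/(2z)})^z) ≥ Tr ρ; equivalently, D_{α,z}(ρ||σ) ≤ 0 whenever ρ ≤ σ (Order Axiom, case 0 < α < 1). -/
open Matrix Filter
open scoped ComplexOrder

/-- Real power of a matrix, defined via the Hermitian functional calculus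
(with the convention `(0:ℝ) ^ t = 0` for `t ≠ 0` from `Real.rpow`);
junk value `0` for non-Hermitian matrices. -/
noncomputable def mpow {n : Type*} [Fintype n] [DecidableEq n]
    (A : Matrix n n ℂ) (t : ℝ) : Matrix n n ℂ :=
  if hA : A.IsHermitian then hA.cfc (fun x => x ^ t) else 0

/-- The α-z trace functional `f_{α,z}(ρ‖σ) = Tr((ρ^{α/2z} σ^{(1-α)/z} ρ^{α/2z})^z)`. -/
noncomputable def traceFun {n : Type*} [Fintype n] [DecidableEq n]
    (α z : ℝ) (ρ σ : Matrix n n ℂ) : ℂ :=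
  Matrix.trace (mpow (mpow ρ (α / (2 * z)) * mpow σ ((1 - α) / z) * mpow ρ (α / (2 * z))) z)

/-- The α-z relative Rényi entropy `D_{α,z}(ρ‖σ) = (α-1)⁻¹ log₂ (f_{α,z}(ρ‖σ)/Tr ρ)`. -/
noncomputable def Dent {n : Type*} [Fintype n] [DecidableEq n]
    (α z : ℝ) (ρ σ : Matrix n n ℂ) : ℝ :=
  (α - 1)⁻¹ * Real.logb 2 ((traceFun α z ρ σ).re / (Matrix.trace ρ).re)


section Aux
open scoped MatrixOrder Matrix.Norms.L2Operator

theorem aux_mpow_eq {n : Type*} [Fintype n] [DecidableEq n] {A : Matrix n n ℂ}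
    (hA : 0 ≤ A) (t : ℝ) : mpow A t = A ^ t := by
  have h : A.IsHermitian := (Matrix.nonneg_iff_posSemidef.1 hA).1
  rw [mpow, dif_pos h, ← h.cfc_eq, CFC.rpow_eq_cfc_real hA]

theorem aux_diag {n : Type*} [Fintype n] [DecidableEq n] {X : Matrix n n ℂ}
    (hX : X.IsHermitian) (g : ℝ → ℝ) (U : Matrix n n ℂ) (i : n) :
    (star U * hX.cfc g * U) i i =
      ((∑ j, Complex.normSq ((star U * (hX.eigenvectorUnitary : Matrix n n ℂ)) i j)
        * g (hX.eigenvalues j) : ℝ) : ℂ) := by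
  set V : Matrix n n ℂ := (hX.eigenvectorUnitary : Matrix n n ℂ) with hV
  have h1 : star U * hX.cfc g * U
      = (star U * V) * diagonal (fun j => ((g (hX.eigenvalues j) : ℝ) : ℂ)) * star (star U * V) := by
    rw [Matrix.IsHermitian.cfc, Unitary.conjStarAlgAut_apply]
    simp only [star_mul, star_star, mul_assoc, hV]
    rfl
  rw [h1, Matrix.mul_apply]
  push_cast
  refine Finset.sum_congr rfl fun j _ => ?_
  rw [Matrix.mul_diagonal, Matrix.star_apply, ← Complex.mul_conj]
  simp only [RCLike.star_def]
  ring

theorem aux_row {n : Type*} [Fintype n] [DecidableEq n] {W : Matrix n n ℂ}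
    (hW : W * star W = 1) (i : n) : ∑ j, Complex.normSq (W i j) = 1 := by
  have h := congrFun (congrFun hW i) i
  rw [Matrix.mul_apply, Matrix.one_apply_eq] at h
  have h2 : ((∑ j, Complex.normSq (W i j) : ℝ) : ℂ) = 1 := by
    rw [← h]
    push_cast
    refine Finset.sum_congr rfl fun j _ => ?_
    rw [Matrix.star_apply, ← Complex.mul_conj]
    rfl
  exact_mod_cast h2

theorem aux_conj_trace {n : Type*} [Fintype n] [DecidableEq n] {U : Matrix n n ℂ}
    (hU : U * star U = 1) (M : Matrix n n ℂ) : trace (star U * M * U) = trace M := by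
  rw [Matrix.trace_mul_comm, ← mul_assoc, hU, one_mul]

theorem aux_cfc_id {n : Type*} [Fintype n] [DecidableEq n] {X : Matrix n n ℂ}
    (hX : X.IsHermitian) : hX.cfc (fun x => x) = X := by
  rw [← hX.cfc_eq]
  exact cfc_id' ℝ X hX

theorem aux_trace_mono_convex {n : Type*} [Fintype n] [DecidableEq n] {X Y : Matrix n n ℂ}
    (hY : Y.PosSemidef) (hX : X.PosSemidef) (h : (X - Y).PosSemidef) {z : ℝ} (hz : 1 ≤ z) :
    (trace (hY.1.cfc (fun x => x ^ z))).re ≤ (trace (hX.1.cfc (fun x => x ^ z))).re := by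
  set U : Matrix n n ℂ := (hY.1.eigenvectorUnitary : Matrix n n ℂ) with hUdef
  set V : Matrix n n ℂ := (hX.1.eigenvectorUnitary : Matrix n n ℂ) with hVdef
  have hU : U * star U = 1 := Unitary.coe_mul_star_self _
  have hU' : star U * U = 1 := Unitary.coe_star_mul_self _
  have hV : V * star V = 1 := Unitary.coe_mul_star_self _
  have hW : (star U * V) * star (star U * V) = 1 := by
    rw [star_mul, star_star, mul_assoc, ← mul_assoc V, hV, one_mul, hU']
  rw [← aux_conj_trace hU (hY.1.cfc _), ← aux_conj_trace hU (hX.1.cfc _)]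
  simp only [Matrix.trace, Matrix.diag, Complex.re_sum]
  refine Finset.sum_le_sum fun i _ => ?_
  have hYd : ∀ g : ℝ → ℝ, (star U * hY.1.cfc g * U) i i = ((g (hY.1.eigenvalues i) : ℝ) : ℂ) := by
    intro g
    rw [aux_diag, ← hUdef, hU', Finset.sum_eq_single i]
    · simp
    · intro j _ hj
      simp [Matrix.one_apply_ne hj.symm]
    · simp
  have hle : hY.1.eigenvalues i ≤
      ∑ j, Complex.normSq ((star U * V) i j) * hX.1.eigenvalues j := by
    have h1 : (star U * (X - Y) * U).PosSemidef := h.conjTranspose_mul_mul_same U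
    have h2 : (0 : ℂ) ≤ (star U * (X - Y) * U) i i := h1.diag_nonneg
    have h3 : (star U * (X - Y) * U) i i =
        ((∑ j, Complex.normSq ((star U * V) i j) * hX.1.eigenvalues j : ℝ) : ℂ)
          - ((hY.1.eigenvalues i : ℝ) : ℂ) := by
      rw [← aux_diag hX.1 (fun x => x), ← hYd (fun x => x), aux_cfc_id, aux_cfc_id, mul_sub,
        sub_mul, Matrix.sub_apply]
    rw [h3, ← Complex.ofReal_sub, Complex.zero_le_real] at h2
    linarith
  rw [hYd, aux_diag, Complex.ofReal_re, Complex.ofReal_re]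
  refine (Real.rpow_le_rpow (hY.eigenvalues_nonneg i) hle (by linarith)).trans ?_
  have := (convexOn_rpow hz).map_sum_le (t := Finset.univ)
    (w := fun j => Complex.normSq ((star U * V) i j)) (p := hX.1.eigenvalues)
    (fun j _ => Complex.normSq_nonneg _) (aux_row hW i) (fun j _ => hX.eigenvalues_nonneg j)
  simpa only [smul_eq_mul] using this

theorem aux_trace_mono {n : Type*} [Fintype n] [DecidableEq n] {X Y : Matrix n n ℂ}
    (hY : 0 ≤ Y) (h : Y ≤ X) {z : ℝ} (hz : 0 ≤ z) :
    (trace (Y ^ z)).re ≤ (trace (X ^ z)).re := by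
  rcases le_total z 1 with h1 | h1
  · have h2 : Y ^ z ≤ X ^ z := CFC.rpow_le_rpow ⟨hz, h1⟩ h
    have h3 := (Matrix.le_iff.1 h2).trace_nonneg
    rw [Matrix.trace_sub, Complex.le_def] at h3
    have := h3.1
    simp at this
    exact this
  · have hX : 0 ≤ X := hY.trans h
    have hY' := Matrix.nonneg_iff_posSemidef.1 hY
    have hX' := Matrix.nonneg_iff_posSemidef.1 hX
    have := aux_trace_mono_convex hY' hX' (Matrix.le_iff.1 h) h1
    rwa [← hY'.1.cfc_eq, ← hX'.1.cfc_eq, ← CFC.rpow_eq_cfc_real hY,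
      ← CFC.rpow_eq_cfc_real hX] at this

set_option maxHeartbeats 2000000 in
theorem aux_main {n : Type*} [Fintype n] [DecidableEq n] (ρ σ : Matrix n n ℂ)
    (hρ : ρ.PosDef) (hσ : σ.PosDef) (hle : (σ - ρ).PosSemidef)
    (α z : ℝ) (hα0 : 0 < α) (hα1 : α < 1) (hz : 1 - α ≤ z) :
    (Matrix.trace ρ).re ≤ (traceFun α z ρ σ).re := by
  have hz0 : 0 < z := by linarith
  have hρ0 : 0 ≤ ρ := Matrix.nonneg_iff_posSemidef.2 hρ.posSemidef
  have hσ0 : 0 ≤ σ := Matrix.nonneg_iff_posSemidef.2 hσ.posSemidef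
  have hρu : IsUnit ρ := hρ.isUnit
  have hp : (1 - α) / z ∈ Set.Icc (0 : ℝ) 1 :=
    ⟨div_nonneg (by linarith) hz0.le, (div_le_one hz0).2 hz⟩
  have h1 : ρ ^ ((1 - α) / z) ≤ σ ^ ((1 - α) / z) := CFC.rpow_le_rpow hp (Matrix.le_iff.2 hle)
  have hc : IsSelfAdjoint (ρ ^ (α / (2 * z))) := IsSelfAdjoint.of_nonneg CFC.rpow_nonneg
  have h2 := hc.conjugate_le_conjugate h1
  have h3 : ρ ^ (α / (2 * z)) * ρ ^ ((1 - α) / z) * ρ ^ (α / (2 * z)) = ρ ^ (1 / z) := by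
    rw [← CFC.rpow_add hρu, ← CFC.rpow_add hρu]
    congr 1
    field_simp
    ring
  rw [h3] at h2
  have h4 := aux_trace_mono CFC.rpow_nonneg h2 hz0.le
  have h5 : (ρ ^ (1 / z)) ^ z = ρ := by
    rw [CFC.rpow_rpow_of_exponent_nonneg ρ (1 / z) z (by positivity) hz0.le hρ0,
      one_div_mul_cancel hz0.ne', CFC.rpow_one ρ hρ0]
  rw [h5] at h4
  rw [traceFun, aux_mpow_eq hρ0, aux_mpow_eq hσ0, aux_mpow_eq (le_trans CFC.rpow_nonneg h2)]
  exact h4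

end Aux

/-- Order Axiom, case 0 < α < 1: if ρ ≤ σ (Loewner order), 0 < α < 1 and z ≥ 1 - α, then
`f_{α,z}(ρ‖σ) ≥ Tr ρ`, equivalently `D_{α,z}(ρ‖σ) ≤ 0`. -/
theorem order_axiom_alpha_lt_one {d : ℕ} (ρ σ : Matrix (Fin d) (Fin d) ℂ)
    (hρ : ρ.PosDef) (hσ : σ.PosDef) (hle : (σ - ρ).PosSemidef)
    (α z : ℝ) (hα0 : 0 < α) (hα1 : α < 1) (hz : 1 - α ≤ z) :
    (Matrix.trace ρ).re ≤ (traceFun α z ρ σ).re ∧ Dent α z ρ σ ≤ 0 := by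
  have h := aux_main ρ σ hρ hσ hle α z hα0 hα1 hz
  refine ⟨h, ?_⟩
  rw [Dent]
  have hinv : (α - 1)⁻¹ ≤ 0 := inv_nonpos.2 (by linarith)
  refine mul_nonpos_of_nonpos_of_nonneg hinv ?_
  have h0 : (0 : ℝ) ≤ (Matrix.trace ρ).re := (Complex.le_def.1 hρ.posSemidef.trace_nonneg).1
  rcases h0.eq_or_lt with h0 | h0
  · rw [← h0]; simp
  · exact Real.logb_nonneg (by norm_num) ((one_le_div h0).2 h)
end

section
/- Let 0 < α ≤ 1 and z ≥ max(α, 1−α). Then the map (ρ, σ) ↦ f_{α,z}(ρ||σ) = Tr((ρ^{α/(2z)} σ^{(1−α)/z} ρ^{α/(2z)})^z) is jointly concave on pairs of positive definite d×d complex matrices: for all positive definite ρ₁, ρ₂, σ₁, σ₂ and all t ∈ [0,1], f_{α,z}(tρ₁ + (1−t)ρ₂ || tσ₁ + (1−t)σ₂) ≥ t·f_{α,z}(ρ₁||σ₁) + (1−t)·f_{α,z}(ρ₂||σ₂). -/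
open Matrix Filter
open scoped ComplexOrder

section helpers
variable {n : Type*} [Fintype n] [DecidableEq n]

lemma mpow_eq_cfc (A : Matrix n n ℂ) (t : ℝ) : mpow A t = cfc (fun x : ℝ => x ^ t) A := by
  unfold mpow
  split_ifs with h
  · exact (h.cfc_eq _).symm
  · exact (cfc_apply_of_not_predicate A (fun h' => h h')).symm

lemma contOn_spec (A : Matrix n n ℂ) (f : ℝ → ℝ) : ContinuousOn f (spectrum ℝ A) :=
  (Matrix.finite_real_spectrum (A := A)).continuousOn f

lemma spec_pos {A : Matrix n n ℂ} (hA : A.PosDef) {x : ℝ} (hx : x ∈ spectrum ℝ A) : 0 < x := by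
  rw [hA.1.spectrum_real_eq_range_eigenvalues] at hx
  obtain ⟨i, rfl⟩ := hx
  exact hA.eigenvalues_pos i

lemma mpow_isHermitian (A : Matrix n n ℂ) (t : ℝ) : (mpow A t).IsHermitian := by
  rw [mpow_eq_cfc]
  exact cfc_predicate (R := ℝ) _ A

lemma mpow_add {A : Matrix n n ℂ} (hA : A.PosDef) (s t : ℝ) :
    mpow A s * mpow A t = mpow A (s + t) := by
  simp only [mpow_eq_cfc]
  rw [← cfc_mul _ _ A (contOn_spec _ _) (contOn_spec _ _)]
  exact cfc_congr fun x hx => (Real.rpow_add (spec_pos hA hx) s t).symm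

lemma mpow_zero {A : Matrix n n ℂ} (hA : A.PosDef) : mpow A 0 = 1 := by
  rw [mpow_eq_cfc]
  simp only [Real.rpow_zero]
  exact cfc_const_one ℝ A hA.1

lemma mpow_one {A : Matrix n n ℂ} (hA : A.PosDef) : mpow A 1 = A := by
  rw [mpow_eq_cfc]
  simp only [Real.rpow_one]
  exact cfc_id' ℝ A hA.1

lemma mpow_mpow {A : Matrix n n ℂ} (hA : A.PosDef) (s t : ℝ) :
    mpow (mpow A s) t = mpow A (s * t) := by
  simp only [mpow_eq_cfc]
  have hc : ContinuousOn (fun x : ℝ => x ^ t) ((fun x : ℝ => x ^ s) '' spectrum ℝ A) :=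
    ((Matrix.finite_real_spectrum (A := A)).image _).continuousOn _
  rw [← cfc_comp' (fun x : ℝ => x ^ t) (fun x : ℝ => x ^ s) A hc (contOn_spec _ _) hA.1.isSelfAdjoint]
  exact cfc_congr fun x hx => (Real.rpow_mul (spec_pos hA hx).le s t).symm

lemma mpow_posDef {A : Matrix n n ℂ} (hA : A.PosDef) (t : ℝ) : (mpow A t).PosDef := by
  have h2 : mpow A t = (mpow A (t/2))ᴴ * mpow A (t/2) := by
    rw [(mpow_isHermitian A (t/2)).eq, mpow_add hA]; ring_nf
  have h3 : mpow A (-(t/2)) * mpow A (t/2) = 1 := by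
    rw [mpow_add hA]; simp [mpow_zero hA]
  rw [h2]
  apply Matrix.PosDef.conjTranspose_mul_self
  apply Matrix.mulVec_injective_of_isUnit
  exact IsUnit.of_mul_eq_one_right _ h3

lemma mpow_trace_eq_of_charpoly {A B : Matrix n n ℂ} (hA : A.IsHermitian) (hB : B.IsHermitian)
    (h : A.charpoly = B.charpoly) (t : ℝ) : (mpow A t).trace = (mpow B t).trace := by
  have key : ∀ {A : Matrix n n ℂ} (hA : A.IsHermitian), (mpow A t).trace =
      (A.charpoly.roots.map (fun x : ℂ => ((x.re ^ t : ℝ) : ℂ))).sum := by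
    intro A hA
    rw [hA.roots_charpoly_eq_eigenvalues]
    unfold mpow
    rw [dif_pos hA, Matrix.IsHermitian.cfc, Unitary.conjStarAlgAut_apply, Matrix.trace_mul_comm,
      ← mul_assoc]
    simp [Matrix.trace]
  rw [key hA, key hB, h]

/-- weights -/
noncomputable def wgt {A B : Matrix n n ℂ} (hA : A.IsHermitian) (hB : B.IsHermitian)
    (K : Matrix n n ℂ) : Matrix n n ℂ :=
  (hA.eigenvectorUnitary : Matrix n n ℂ)ᴴ * K * (hB.eigenvectorUnitary : Matrix n n ℂ)

lemma trace_form_aux (f g : n → ℝ) (W : Matrix n n ℂ) :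
    (Wᴴ * diagonal (fun i => (f i : ℂ)) * W * diagonal (fun i => (g i : ℂ))).trace.re =
      ∑ i, ∑ j, f i * g j * Complex.normSq (W i j) := by
  simp only [Matrix.trace, Matrix.diag_apply, Matrix.mul_diagonal]
  simp only [Matrix.mul_apply (M := Wᴴ * _), Matrix.mul_diagonal,
    Matrix.conjTranspose_apply, Complex.re_sum, Finset.sum_mul]
  rw [Finset.sum_comm]
  refine Finset.sum_congr rfl fun i _ => Finset.sum_congr rfl fun j _ => ?_
  simp [Complex.normSq_apply]
  ring

lemma trace_form {A B : Matrix n n ℂ} (hA : A.IsHermitian) (hB : B.IsHermitian)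
    (K : Matrix n n ℂ) (f g : ℝ → ℝ) :
    (Kᴴ * cfc f A * K * cfc g B).trace.re =
      ∑ i, ∑ j, f (hA.eigenvalues i) * g (hB.eigenvalues j) * Complex.normSq (wgt hA hB K i j) := by
  rw [← trace_form_aux (fun i => f (hA.eigenvalues i)) (fun i => g (hB.eigenvalues i)),
    hA.cfc_eq, hB.cfc_eq]
  simp only [Matrix.IsHermitian.cfc, Unitary.conjStarAlgAut_apply, wgt, Matrix.conjTranspose_mul,
    Matrix.conjTranspose_conjTranspose, Matrix.star_eq_conjTranspose]
  congr 1
  rw [← Matrix.mul_assoc _ _ ((hB.eigenvectorUnitary : Matrix n n ℂ)ᴴ), Matrix.trace_mul_comm]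
  congr 1
  simp only [Matrix.mul_assoc]
  rfl

lemma trace_form_l {A B : Matrix n n ℂ} (hA : A.IsHermitian) (hB : B.IsHermitian)
    (K : Matrix n n ℂ) :
    (Kᴴ * A * K).trace.re =
      ∑ i, ∑ j, hA.eigenvalues i * Complex.normSq (wgt hA hB K i j) := by
  have := trace_form hA hB K (fun x => x) (fun _ => 1)
  rw [cfc_id' ℝ A hA.isSelfAdjoint, cfc_const_one ℝ B hB.isSelfAdjoint] at this
  simpa using this

lemma trace_form_r {A B : Matrix n n ℂ} (hA : A.IsHermitian) (hB : B.IsHermitian)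
    (K : Matrix n n ℂ) :
    (Kᴴ * K * B).trace.re =
      ∑ i, ∑ j, hB.eigenvalues j * Complex.normSq (wgt hA hB K i j) := by
  have := trace_form hA hB K (fun _ => 1) (fun x => x)
  rw [cfc_id' ℝ B hB.isSelfAdjoint, cfc_const_one ℝ A hA.isSelfAdjoint] at this
  simpa using this

lemma trace_form_pow {A B : Matrix n n ℂ} (hA : A.IsHermitian) (hB : B.IsHermitian)
    (K : Matrix n n ℂ) (s t : ℝ) :
    (Kᴴ * mpow A s * K * mpow B t).trace.re =
      ∑ i, ∑ j, (hA.eigenvalues i)^s * (hB.eigenvalues j)^t *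
        Complex.normSq (wgt hA hB K i j) := by
  rw [mpow_eq_cfc, mpow_eq_cfc, trace_form hA hB]

/-- scalar parallel sum -/
noncomputable def psum (τ a b : ℝ) : ℝ := a * b / (a + τ * b)

lemma scalar_var {τ a b : ℝ} (hτ : 0 < τ) (ha : 0 < a) (hb : 0 < b) (k x : ℂ) :
    τ * (Complex.normSq k * psum τ a b) ≤
      a * Complex.normSq x + τ * (b * Complex.normSq (k - x)) := by
  unfold psum
  have : 0 < a + τ * b := by positivity
  rw [← mul_div_assoc, ← mul_div_assoc, div_le_iff₀ this]
  simp only [Complex.normSq_apply, Complex.sub_re, Complex.sub_im]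
  nlinarith [sq_nonneg (a * x.re - τ * b * (k.re - x.re)),
    sq_nonneg (a * x.im - τ * b * (k.im - x.im))]

lemma scalar_var_eq {τ a b : ℝ} (hτ : 0 < τ) (ha : 0 < a) (hb : 0 < b) (k : ℂ) :
    a * Complex.normSq (k * ((τ * b / (a + τ * b) : ℝ) : ℂ)) +
      τ * (b * Complex.normSq (k - k * ((τ * b / (a + τ * b) : ℝ) : ℂ))) =
    τ * (Complex.normSq k * psum τ a b) := by
  unfold psum
  have : 0 < a + τ * b := by positivity
  rw [show k - k * ((τ * b / (a + τ * b) : ℝ) : ℂ) = k * ((a / (a + τ * b) : ℝ) : ℂ) by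
    have h : (a / (a + τ * b) : ℝ) = 1 - τ * b / (a + τ * b) := by field_simp; ring
    rw [h]; push_cast; ring]
  simp only [Complex.normSq_mul, Complex.normSq_ofReal]
  field_simp
  ring

lemma wgt_sub {A B : Matrix n n ℂ} (hA : A.IsHermitian) (hB : B.IsHermitian)
    (K X : Matrix n n ℂ) : wgt hA hB (K - X) = wgt hA hB K - wgt hA hB X := by
  simp [wgt, Matrix.mul_sub, Matrix.sub_mul]

/-- The parallel sum functional. -/
noncomputable def Jf {A B : Matrix n n ℂ} (hA : A.IsHermitian) (hB : B.IsHermitian)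
    (K : Matrix n n ℂ) (τ : ℝ) : ℝ :=
  ∑ i, ∑ j, Complex.normSq (wgt hA hB K i j) * psum τ (hA.eigenvalues i) (hB.eigenvalues j)

lemma var_le {A B : Matrix n n ℂ} (hA : A.PosDef) (hB : B.PosDef)
    (K X : Matrix n n ℂ) {τ : ℝ} (hτ : 0 < τ) :
    τ * Jf hA.1 hB.1 K τ ≤ (Xᴴ * A * X).trace.re + τ * ((K - X)ᴴ * (K - X) * B).trace.re := by
  rw [trace_form_l hA.1 hB.1, trace_form_r hA.1 hB.1, wgt_sub, Jf]
  simp only [Finset.mul_sum, ← Finset.sum_add_distrib]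
  exact Finset.sum_le_sum fun i _ => Finset.sum_le_sum fun j _ =>
    scalar_var hτ (hA.eigenvalues_pos i) (hB.eigenvalues_pos j) _ _

lemma var_eq {A B : Matrix n n ℂ} (hA : A.PosDef) (hB : B.PosDef)
    (K : Matrix n n ℂ) {τ : ℝ} (hτ : 0 < τ) :
    ∃ X : Matrix n n ℂ,
    (Xᴴ * A * X).trace.re + τ * ((K - X)ᴴ * (K - X) * B).trace.re = τ * Jf hA.1 hB.1 K τ := by
  let Y : Matrix n n ℂ := Matrix.of fun i j => wgt hA.1 hB.1 K i j *
    ((τ * hB.1.eigenvalues j / (hA.1.eigenvalues i + τ * hB.1.eigenvalues j) : ℝ) : ℂ)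
  have hY : wgt hA.1 hB.1 ((hA.1.eigenvectorUnitary : Matrix n n ℂ) * Y *
      (hB.1.eigenvectorUnitary : Matrix n n ℂ)ᴴ) = Y := by
    have h1 : (hA.1.eigenvectorUnitary : Matrix n n ℂ)ᴴ * (hA.1.eigenvectorUnitary : Matrix n n ℂ)
      = 1 := Unitary.coe_star_mul_self hA.1.eigenvectorUnitary
    have h2 : (hB.1.eigenvectorUnitary : Matrix n n ℂ)ᴴ * (hB.1.eigenvectorUnitary : Matrix n n ℂ)
      = 1 := Unitary.coe_star_mul_self hB.1.eigenvectorUnitary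
    unfold wgt
    rw [← Matrix.mul_assoc, ← Matrix.mul_assoc, h1, Matrix.mul_assoc, h2]
    simp
  refine ⟨(hA.1.eigenvectorUnitary : Matrix n n ℂ) * Y *
      (hB.1.eigenvectorUnitary : Matrix n n ℂ)ᴴ, ?_⟩
  · rw [trace_form_l hA.1 hB.1, trace_form_r hA.1 hB.1, wgt_sub, Jf, hY]
    simp only [Finset.mul_sum, ← Finset.sum_add_distrib]
    exact Finset.sum_congr rfl fun i _ => Finset.sum_congr rfl fun j _ =>
      scalar_var_eq hτ (hA.eigenvalues_pos i) (hB.eigenvalues_pos j) _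

lemma Jf_concave {A₁ A₂ B₁ B₂ A B : Matrix n n ℂ} (hA₁ : A₁.PosDef) (hA₂ : A₂.PosDef)
    (hB₁ : B₁.PosDef) (hB₂ : B₂.PosDef) (hA : A.PosDef) (hB : B.PosDef)
    (K : Matrix n n ℂ) {τ t : ℝ} (hτ : 0 < τ) (ht0 : 0 ≤ t) (ht1 : t ≤ 1)
    (eA : A = t • A₁ + (1 - t) • A₂) (eB : B = t • B₁ + (1 - t) • B₂) :
    t * Jf hA₁.1 hB₁.1 K τ + (1 - t) * Jf hA₂.1 hB₂.1 K τ ≤ Jf hA.1 hB.1 K τ := by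
  obtain ⟨X, hX⟩ := var_eq hA hB K hτ
  have h1 := var_le hA₁ hB₁ K X hτ
  have h2 := var_le hA₂ hB₂ K X hτ
  have h3 : (Xᴴ * A * X).trace.re = t * (Xᴴ * A₁ * X).trace.re +
      (1 - t) * (Xᴴ * A₂ * X).trace.re := by
    rw [eA]; simp [Matrix.mul_add, Matrix.add_mul]
  have h4 : ((K - X)ᴴ * (K - X) * B).trace.re = t * ((K - X)ᴴ * (K - X) * B₁).trace.re +
      (1 - t) * ((K - X)ᴴ * (K - X) * B₂).trace.re := by
    rw [eB]; simp [Matrix.mul_add]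
  have h5 := mul_le_mul_of_nonneg_left h1 ht0
  have h6 := mul_le_mul_of_nonneg_left h2 (sub_nonneg.2 ht1)
  refine le_of_mul_le_mul_left ?_ hτ
  rw [← hX, h3, h4]
  linarith

lemma psum_principle_lt {ι : Type*} [Fintype ι] (w a b : ι → ℝ) (ha : ∀ k, 0 < a k)
    (hb : ∀ k, 0 < b k) (h : ∀ τ : ℝ, 0 < τ → 0 ≤ ∑ k, w k * psum τ (a k) (b k))
    {p : ℝ} (hp : p ∈ Set.Ioo (0 : ℝ) 1) : 0 ≤ ∑ k, w k * (a k ^ p * b k ^ (1 - p)) := by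
  obtain ⟨μ, hμ⟩ := Real.exists_measure_rpow_eq_integral_rpowIntegrand₀₁ hp
  have h1 : ∀ k, w k * (a k ^ p * b k ^ (1 - p)) =
      ∫ τ in Set.Ioi (0 : ℝ), w k * b k * Real.rpowIntegrand₀₁ p τ (a k / b k) ∂μ := by
    intro k
    rw [MeasureTheory.integral_const_mul, ← (hμ (a k / b k) (div_pos (ha k) (hb k)).le).2,
      Real.div_rpow (ha k).le (hb k).le, Real.rpow_sub (hb k), Real.rpow_one]
    ring
  simp only [h1]
  rw [← MeasureTheory.integral_finsetSum]
  · refine MeasureTheory.setIntegral_nonneg measurableSet_Ioi fun τ hτ => ?_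
    have hτ' : 0 < τ := hτ
    have : ∑ k, w k * b k * Real.rpowIntegrand₀₁ p τ (a k / b k) =
        τ ^ (p - 1) * ∑ k, w k * psum τ (a k) (b k) := by
      rw [Finset.mul_sum]
      refine Finset.sum_congr rfl fun k _ => ?_
      have := ha k
      have := hb k
      rw [Real.rpowIntegrand₀₁_eq_pow_div hp hτ'.le (div_pos (ha k) (hb k)).le, psum]
      have : 0 < a k + τ * b k := by positivity
      have : τ + a k / b k = (a k + τ * b k) / b k := by field_simp; ring
      rw [this]
      field_simp
    rw [this]
    exact mul_nonneg (by positivity) (h τ hτ')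
  · intro k _
    exact ((hμ (a k / b k) (div_pos (ha k) (hb k)).le).1).const_mul _

lemma psum_principle {ι : Type*} [Fintype ι] (w a b : ι → ℝ) (ha : ∀ k, 0 < a k)
    (hb : ∀ k, 0 < b k) (h : ∀ τ : ℝ, 0 < τ → 0 ≤ ∑ k, w k * psum τ (a k) (b k))
    {p : ℝ} (hp0 : 0 < p) (hp1 : p ≤ 1) : 0 ≤ ∑ k, w k * (a k ^ p * b k ^ (1 - p)) := by
  rcases hp1.lt_or_eq with h1 | rfl
  · exact psum_principle_lt w a b ha hb h ⟨hp0, h1⟩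
  have hc : Continuous fun p : ℝ => ∑ k, w k * (a k ^ p * b k ^ (1 - p)) := by
    refine continuous_finsetSum _ fun k _ => continuous_const.mul (Continuous.mul ?_ ?_)
    · exact continuous_const.rpow continuous_id fun _ => Or.inl (ha k).ne'
    · exact continuous_const.rpow (continuous_const.sub continuous_id) fun _ => Or.inl (hb k).ne'
  have ht : Tendsto (fun p : ℝ => ∑ k, w k * (a k ^ p * b k ^ (1 - p))) (nhdsWithin 1 (Set.Iio 1))
      (nhds (∑ k, w k * (a k ^ (1:ℝ) * b k ^ (1 - (1:ℝ))))) :=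
    (hc.tendsto 1).mono_left nhdsWithin_le_nhds
  refine ge_of_tendsto ht ?_
  filter_upwards [Ioo_mem_nhdsLT (zero_lt_one (α := ℝ))] with p hp
  exact psum_principle_lt w a b ha hb h hp

lemma Jf_prod {A B : Matrix n n ℂ} (hA : A.IsHermitian) (hB : B.IsHermitian)
    (K : Matrix n n ℂ) (τ : ℝ) : Jf hA hB K τ = ∑ x : n × n,
      Complex.normSq (wgt hA hB K x.1 x.2) * psum τ (hA.eigenvalues x.1) (hB.eigenvalues x.2) := by
  rw [Jf, Fintype.sum_prod_type]

lemma trace_pow_prod {A B : Matrix n n ℂ} (hA : A.IsHermitian) (hB : B.IsHermitian)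
    (K : Matrix n n ℂ) (s t : ℝ) :
    (Kᴴ * mpow A s * K * mpow B t).trace.re = ∑ x : n × n,
      Complex.normSq (wgt hA hB K x.1 x.2) * ((hA.eigenvalues x.1)^s * (hB.eigenvalues x.2)^t) := by
  rw [trace_form_pow hA hB, Fintype.sum_prod_type]
  exact Finset.sum_congr rfl fun i _ => Finset.sum_congr rfl fun j _ => by ring

/-- Lieb concavity. -/
lemma lieb_concavity {A₁ A₂ B₁ B₂ A B : Matrix n n ℂ} (hA₁ : A₁.PosDef) (hA₂ : A₂.PosDef)
    (hB₁ : B₁.PosDef) (hB₂ : B₂.PosDef) (hA : A.PosDef) (hB : B.PosDef)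
    (K : Matrix n n ℂ) {t : ℝ} (ht0 : 0 ≤ t) (ht1 : t ≤ 1)
    (eA : A = t • A₁ + (1 - t) • A₂) (eB : B = t • B₁ + (1 - t) • B₂)
    {p : ℝ} (hp0 : 0 < p) (hp1 : p ≤ 1) :
    t * (Kᴴ * mpow A₁ p * K * mpow B₁ (1 - p)).trace.re +
      (1 - t) * (Kᴴ * mpow A₂ p * K * mpow B₂ (1 - p)).trace.re ≤
      (Kᴴ * mpow A p * K * mpow B (1 - p)).trace.re := by
  have key := psum_principle (ι := (n × n) ⊕ ((n × n) ⊕ (n × n)))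
    (Sum.elim (fun x => Complex.normSq (wgt hA.1 hB.1 K x.1 x.2))
      (Sum.elim (fun x => - t * Complex.normSq (wgt hA₁.1 hB₁.1 K x.1 x.2))
        (fun x => - (1 - t) * Complex.normSq (wgt hA₂.1 hB₂.1 K x.1 x.2))))
    (Sum.elim (fun x => hA.1.eigenvalues x.1)
      (Sum.elim (fun x => hA₁.1.eigenvalues x.1) (fun x => hA₂.1.eigenvalues x.1)))
    (Sum.elim (fun x => hB.1.eigenvalues x.2)
      (Sum.elim (fun x => hB₁.1.eigenvalues x.2) (fun x => hB₂.1.eigenvalues x.2)))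
    (by rintro (x | x | x) <;> simp [hA.eigenvalues_pos, hA₁.eigenvalues_pos, hA₂.eigenvalues_pos])
    (by rintro (x | x | x) <;> simp [hB.eigenvalues_pos, hB₁.eigenvalues_pos, hB₂.eigenvalues_pos])
    (by
      intro τ hτ
      have := Jf_concave hA₁ hA₂ hB₁ hB₂ hA hB K hτ ht0 ht1 eA eB
      simp only [Jf_prod] at this
      simp only [Fintype.sum_sum_type, Sum.elim_inl, Sum.elim_inr, mul_assoc, ← Finset.mul_sum]
      linarith)
    hp0 hp1
  simp only [trace_pow_prod hA₁.1 hB₁.1, trace_pow_prod hA₂.1 hB₂.1, trace_pow_prod hA.1 hB.1]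
  simp only [Fintype.sum_sum_type, Sum.elim_inl, Sum.elim_inr, mul_assoc, ← Finset.mul_sum] at key
  linarith

/-- general comparison of two-variable traces -/
lemma trace_compare {A B : Matrix n n ℂ} (hA : A.PosDef) (hB : B.PosDef)
    (c₁ c₂ c₃ s₁ s₂ s₃ t₁ t₂ t₃ : ℝ)
    (h : ∀ x y : ℝ, 0 < x → 0 < y → c₁ * (x ^ s₁ * y ^ t₁) ≤ c₂ * (x ^ s₂ * y ^ t₂) +
      c₃ * (x ^ s₃ * y ^ t₃)) :
    c₁ * (mpow A s₁ * mpow B t₁).trace.re ≤ c₂ * (mpow A s₂ * mpow B t₂).trace.re +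
      c₃ * (mpow A s₃ * mpow B t₃).trace.re := by
  have e : ∀ s t, (mpow A s * mpow B t).trace.re = ∑ x : n × n,
      Complex.normSq (wgt hA.1 hB.1 1 x.1 x.2) *
        ((hA.1.eigenvalues x.1)^s * (hB.1.eigenvalues x.2)^t) := by
    intro s t
    rw [← trace_pow_prod hA.1 hB.1]; simp
  simp only [e, Finset.mul_sum, ← Finset.sum_add_distrib]
  refine Finset.sum_le_sum fun x _ => ?_
  have := mul_le_mul_of_nonneg_left (h _ _ (hA.eigenvalues_pos x.1) (hB.eigenvalues_pos x.2))
    (Complex.normSq_nonneg (wgt hA.1 hB.1 1 x.1 x.2))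
  linarith

lemma trace_young {A B : Matrix n n ℂ} (hA : A.PosDef) (hB : B.PosDef) {p : ℝ}
    (hp0 : 0 ≤ p) (hp1 : p ≤ 1) :
    (mpow A p * mpow B (1 - p)).trace.re ≤ p * A.trace.re + (1 - p) * B.trace.re := by
  have := trace_compare hA hB 1 p (1 - p) p 1 0 (1 - p) 0 1 (by
    intro x y hx hy
    have := Real.geom_mean_le_arith_mean2_weighted hp0 (sub_nonneg.2 hp1) hx.le hy.le (by ring)
    simpa using this)
  simpa [mpow_one, mpow_zero, hA, hB] using this

/-- Epstein concavity. -/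
lemma epstein {A₁ A₂ A : Matrix n n ℂ} (hA₁ : A₁.PosDef) (hA₂ : A₂.PosDef) (hA : A.PosDef)
    {K : Matrix n n ℂ} (hK : K.PosDef) {t : ℝ} (ht0 : 0 ≤ t) (ht1 : t ≤ 1)
    (eA : A = t • A₁ + (1 - t) • A₂) {p : ℝ} (hp0 : 0 < p) (hp1 : p ≤ 1) :
    t * (mpow (K * mpow A₁ p * K) (1 / p)).trace.re +
      (1 - t) * (mpow (K * mpow A₂ p * K) (1 / p)).trace.re ≤
      (mpow (K * mpow A p * K) (1 / p)).trace.re := by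
  have hpd : ∀ {A : Matrix n n ℂ}, A.PosDef → (K * mpow A p * K).PosDef := by
    intro A hA
    have := (mpow_posDef hA p).conjTranspose_mul_mul_same (B := K)
      (Matrix.mulVec_injective_of_isUnit hK.isUnit)
    rwa [hK.1.eq] at this
  have hS₁ := mpow_posDef (hpd hA₁) (1 / p)
  have hS₂ := mpow_posDef (hpd hA₂) (1 / p)
  have hS := mpow_posDef (hpd hA) (1 / p)
  have hp : ∀ {A : Matrix n n ℂ}, A.PosDef →
      mpow (mpow (K * mpow A p * K) (1 / p)) p = Kᴴ * mpow A p * K := by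
    intro A hA
    rw [mpow_mpow (hpd hA), one_div_mul_cancel hp0.ne', mpow_one (hpd hA), hK.1.eq]
  have hid : ∀ {A : Matrix n n ℂ}, A.PosDef →
      Kᴴ * mpow A p * K * mpow (mpow (K * mpow A p * K) (1 / p)) (1 - p) =
      mpow (K * mpow A p * K) (1 / p) := by
    intro A hA
    have h := mpow_posDef (hpd hA) (1 / p)
    rw [← hp hA, mpow_add h, add_sub_cancel, mpow_one h]
  have hSbar : (t • mpow (K * mpow A₁ p * K) (1 / p) +
      (1 - t) • mpow (K * mpow A₂ p * K) (1 / p)).PosDef := by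
    rcases ht0.eq_or_lt with h | h
    · subst h; simpa using hS₂
    · exact (hS₁.smul h).add_posSemidef (hS₂.posSemidef.smul (sub_nonneg.2 ht1))
  have h1 := lieb_concavity hA₁ hA₂ hS₁ hS₂ hA hSbar K ht0 ht1 eA rfl hp0 hp1
  rw [hid hA₁, hid hA₂, ← hp hA] at h1
  have h2 := trace_young hS hSbar hp0.le hp1
  have h3 : (t • mpow (K * mpow A₁ p * K) (1 / p) +
      (1 - t) • mpow (K * mpow A₂ p * K) (1 / p)).trace.re =
      t * (mpow (K * mpow A₁ p * K) (1 / p)).trace.re +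
      (1 - t) * (mpow (K * mpow A₂ p * K) (1 / p)).trace.re := by simp
  rw [h3] at h2
  refine le_of_mul_le_mul_left ?_ hp0
  linarith

lemma diag_re_pos {A : Matrix n n ℂ} (hA : A.PosDef) (i : n) : 0 < (A i i).re :=
  (Complex.pos_iff.1 hA.diag_pos).1

lemma conj_unitary_posDef {A : Matrix n n ℂ} (hA : A.PosDef) (U : Matrix.unitaryGroup n ℂ) :
    ((U : Matrix n n ℂ)ᴴ * A * (U : Matrix n n ℂ)).PosDef :=
  hA.conjTranspose_mul_mul_same (Matrix.mulVec_injective_of_isUnit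
    (IsUnit.of_mul_eq_one_right _ (Unitary.coe_star_mul_self U)))

/-- diagonal trace formula -/
lemma trace_diag_form (U : Matrix.unitaryGroup n ℂ) (A : Matrix n n ℂ) (x : n → ℝ) :
    (((U : Matrix n n ℂ) * diagonal (fun i => (x i : ℂ)) * (U : Matrix n n ℂ)ᴴ) * A).trace.re =
      ∑ i, x i * (((U : Matrix n n ℂ)ᴴ * A * (U : Matrix n n ℂ)) i i).re := by
  have : (((U : Matrix n n ℂ) * diagonal (fun i => (x i : ℂ)) * (U : Matrix n n ℂ)ᴴ) * A).trace =
      (diagonal (fun i => (x i : ℂ)) * ((U : Matrix n n ℂ)ᴴ * A * (U : Matrix n n ℂ))).trace := by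
    rw [Matrix.mul_assoc, Matrix.mul_assoc, Matrix.trace_mul_comm]
    simp only [Matrix.mul_assoc]
  rw [this]
  simp [Matrix.trace, Matrix.diagonal_mul]

lemma diag_young {K A B : Matrix n n ℂ} (hK : K.PosDef) (hA : A.PosDef) (hB : B.PosDef) {p : ℝ}
    (hp0 : 0 < p) (hp1 : p ≤ 1) :
    (K * mpow A p * K * mpow B (1 - p)).trace.re ≤
      p * (mpow K (2 / p) * A).trace.re + (1 - p) * B.trace.re := by
  set U := hK.1.eigenvectorUnitary with hU
  set k := hK.1.eigenvalues with hk
  have hkpos : ∀ i, 0 < k i := hK.eigenvalues_pos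
  have hUU : (U : Matrix n n ℂ)ᴴ * (U : Matrix n n ℂ) = 1 := Unitary.coe_star_mul_self U
  have hUU' : (U : Matrix n n ℂ) * (U : Matrix n n ℂ)ᴴ = 1 := Unitary.coe_mul_star_self U
  let D : (n → ℝ) → Matrix n n ℂ := fun x =>
    (U : Matrix n n ℂ) * diagonal (fun i => (x i : ℂ)) * (U : Matrix n n ℂ)ᴴ
  have hDmul : ∀ x y, D x * D y = D (fun i => x i * y i) := by
    intro x y
    have : D x * D y = (U : Matrix n n ℂ) * diagonal (fun i => (x i : ℂ)) *
      ((U : Matrix n n ℂ)ᴴ * (U : Matrix n n ℂ)) * diagonal (fun i => (y i : ℂ)) *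
        (U : Matrix n n ℂ)ᴴ := by simp only [D, Matrix.mul_assoc]
    rw [this, hUU, Matrix.mul_one, Matrix.mul_assoc (U : Matrix n n ℂ),
      Matrix.diagonal_mul_diagonal]
    simp [D]
  have hDH : ∀ x, (D x)ᴴ = D x := by
    intro x
    simp only [D, Matrix.conjTranspose_mul, Matrix.conjTranspose_conjTranspose,
      Matrix.diagonal_conjTranspose, Matrix.mul_assoc]
    congr 3
    ext i; simp
  have hDsub : ∀ x y, D x - D y = D (fun i => x i - y i) := by
    intro x y
    simp only [D]
    rw [← Matrix.sub_mul, ← Matrix.mul_sub, Matrix.diagonal_sub]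
    simp
  have hKpow : ∀ s, mpow K s = D (fun i => k i ^ s) := by
    intro s
    rw [mpow_eq_cfc, hK.1.cfc_eq, Matrix.IsHermitian.cfc, Unitary.conjStarAlgAut_apply]
    rfl
  have hKD : K = D k := by
    have := hKpow 1
    simpa [mpow_one hK] using this
  set a : n → ℝ := fun i => (((U : Matrix n n ℂ)ᴴ * A * (U : Matrix n n ℂ)) i i).re with ha
  set b : n → ℝ := fun i => (((U : Matrix n n ℂ)ᴴ * B * (U : Matrix n n ℂ)) i i).re with hb
  have hapos : ∀ i, 0 < a i := fun i => diag_re_pos (conj_unitary_posDef hA U) i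
  have hbpos : ∀ i, 0 < b i := fun i => diag_re_pos (conj_unitary_posDef hB U) i
  have htr : ∀ (x : n → ℝ) (M : Matrix n n ℂ), (D x * M).trace.re =
      ∑ i, x i * (((U : Matrix n n ℂ)ᴴ * M * (U : Matrix n n ℂ)) i i).re :=
    fun x M => trace_diag_form U M x
  have hJ : ∀ τ : ℝ, 0 < τ → Jf hA.1 hB.1 K τ ≤ ∑ i, k i ^ 2 * psum τ (a i) (b i) := by
    intro τ hτ
    have h1 := var_le hA hB K (D fun i => k i * (τ * b i / (a i + τ * b i))) hτ
    refine le_of_mul_le_mul_left (h1.trans_eq ?_) hτ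
    conv_lhs => rw [hKD]
    rw [hDsub, hDH, hDH, hDmul, htr, Matrix.trace_mul_comm, ← Matrix.mul_assoc, hDmul, htr]
    rw [Finset.mul_sum, Finset.mul_sum, ← Finset.sum_add_distrib]
    refine Finset.sum_congr rfl fun i _ => ?_
    have := hapos i
    have := hbpos i
    have : 0 < a i + τ * b i := by positivity
    change _ * a i + τ * (_ * b i) = _
    unfold psum
    field_simp
    ring
  have key := psum_principle (ι := n ⊕ (n × n))
    (Sum.elim (fun i => k i ^ 2) (fun x => - Complex.normSq (wgt hA.1 hB.1 K x.1 x.2)))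
    (Sum.elim a (fun x => hA.1.eigenvalues x.1))
    (Sum.elim b (fun x => hB.1.eigenvalues x.2))
    (by rintro (x | x) <;> simp [hA.eigenvalues_pos, hapos])
    (by rintro (x | x) <;> simp [hB.eigenvalues_pos, hbpos])
    (by
      intro τ hτ
      have := hJ τ hτ
      rw [Jf_prod] at this
      simp only [Fintype.sum_sum_type, Sum.elim_inl, Sum.elim_inr, neg_mul, Finset.sum_neg_distrib]
      linarith)
    hp0 hp1
  have e1 := trace_pow_prod hA.1 hB.1 K p (1 - p)
  rw [hK.1.eq] at e1
  have e2 : B.trace.re = ∑ i, b i := by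
    have := htr (fun _ => 1) B
    have h1 : D (fun _ => 1) = 1 := by simp [D, hUU']
    rw [h1] at this
    simpa using this
  rw [e1, e2, hKpow, htr]
  simp only [Fintype.sum_sum_type, Sum.elim_inl, Sum.elim_inr, neg_mul, Finset.sum_neg_distrib]
    at key
  have h5 : ∑ i, k i ^ 2 * (a i ^ p * b i ^ (1 - p)) ≤
      p * ∑ i, k i ^ (2 / p) * a i + (1 - p) * ∑ i, b i := by
    rw [Finset.mul_sum, Finset.mul_sum, ← Finset.sum_add_distrib]
    refine Finset.sum_le_sum fun i _ => ?_
    have := Real.geom_mean_le_arith_mean2_weighted hp0.le (sub_nonneg.2 hp1)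
      (mul_pos (Real.rpow_pos_of_pos (hkpos i) (2 / p)) (hapos i)).le (hbpos i).le (by ring)
    rw [Real.mul_rpow (Real.rpow_pos_of_pos (hkpos i) (2 / p)).le (hapos i).le,
      ← Real.rpow_mul (hkpos i).le, div_mul_cancel₀ _ hp0.ne', Real.rpow_two] at this
    linarith
  linarith

lemma sandwich_posDef {K A : Matrix n n ℂ} (hK : K.PosDef) (hA : A.PosDef) :
    (K * A * K).PosDef := by
  have := hA.conjTranspose_mul_mul_same (B := K)
    (Matrix.mulVec_injective_of_isUnit hK.isUnit)
  rwa [hK.1.eq] at this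

lemma traceFun_congr {α z : ℝ} {ρ σ ρ' σ' : Matrix n n ℂ} (hρ : ρ.PosDef) (hσ : σ.PosDef)
    (hρ' : ρ'.PosDef) (hσ' : σ'.PosDef)
    (h : (mpow ρ (α / z) * mpow σ ((1 - α) / z)).charpoly =
      (mpow ρ' (α / z) * mpow σ' ((1 - α) / z)).charpoly) :
    traceFun α z ρ σ = traceFun α z ρ' σ' := by
  unfold traceFun
  have e : ∀ {ρ σ : Matrix n n ℂ}, ρ.PosDef →
      (mpow ρ (α / (2 * z)) * mpow σ ((1 - α) / z) * mpow ρ (α / (2 * z))).charpoly =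
      (mpow ρ (α / z) * mpow σ ((1 - α) / z)).charpoly := by
    intro ρ σ hρ
    rw [Matrix.charpoly_mul_comm, ← Matrix.mul_assoc, mpow_add hρ]
    congr 3
    by_cases hz : z = 0
    · simp [hz]
    · field_simp; ring
  refine mpow_trace_eq_of_charpoly (sandwich_posDef (mpow_posDef hρ _) (mpow_posDef hσ _)).1
    (sandwich_posDef (mpow_posDef hρ' _) (mpow_posDef hσ' _)).1 ?_ z
  rw [e hρ, e hρ', h]

lemma traceFun_le {α z : ℝ} (hα0 : 0 < α) (hα1 : α < 1) (hz1 : 1 - α ≤ z)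
    {S T : Matrix n n ℂ} (hS : S.PosDef) (hT : T.PosDef) :
    (traceFun α z S T).re ≤ α * S.trace.re + (1 - α) * T.trace.re := by
  have hz : 0 < z := by linarith
  unfold traceFun
  set M := mpow S (α / (2 * z)) * mpow T ((1 - α) / z) * mpow S (α / (2 * z)) with hM
  have hMpd : M.PosDef := sandwich_posDef (mpow_posDef hS _) (mpow_posDef hT _)
  rcases le_total 1 z with h1 | h1
  · have hW := mpow_posDef hMpd z
    have h := diag_young (mpow_posDef hS (α / (2 * z))) (mpow_posDef hT (1 - α)) hW
      (p := 1 / z) (by positivity) (by rw [div_le_one hz]; exact h1)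
    rw [mpow_mpow hT, mul_one_div, ← hM, mpow_mpow hS, mpow_mpow hMpd] at h
    have e1 : M * mpow M (z * (1 - 1 / z)) = mpow M z := by
      conv_lhs => enter [1]; rw [← mpow_one hMpd]
      rw [mpow_add hMpd]
      congr 1
      field_simp; ring
    have e2 : α / (2 * z) * (2 / (1 / z)) = α := by field_simp
    rw [e1, e2] at h
    have hy := trace_young hS hT hα0.le hα1.le
    have hh : (1 / z) * (mpow M z).trace.re ≤
        (1 / z) * (mpow S α * mpow T (1 - α)).trace.re := by linarith
    exact (le_of_mul_le_mul_left hh (by positivity)).trans hy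
  · have h := trace_compare hMpd hS 1 z (1 - z) z 1 0 0 (1 - 1 / z) 1 (by
      intro x y hx hy
      have := Real.geom_mean_le_arith_mean2_weighted hz.le (sub_nonneg.2 h1)
        (mul_pos hx (Real.rpow_pos_of_pos hy (1 - 1 / z))).le hy.le (by ring)
      rw [Real.mul_rpow hx.le (Real.rpow_pos_of_pos hy _).le, ← Real.rpow_mul hy.le, mul_assoc,
        ← Real.rpow_add hy] at this
      rw [show (1 - 1 / z) * z + (1 - z) = 0 by field_simp; ring] at this
      simpa using this)
    simp only [mpow_one hMpd, mpow_zero hMpd, mpow_zero hS, mpow_one hS, one_mul, mul_one] at h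
    have e : (M * mpow S (1 - 1 / z)).trace =
        (mpow T ((1 - α) / z) * mpow S (1 - (1 - α) / z)).trace := by
      rw [hM, Matrix.mul_assoc, Matrix.trace_mul_comm, ← Matrix.mul_assoc, Matrix.trace_mul_comm,
        mpow_add hS, mpow_add hS]
      congr 3
      field_simp; ring
    have hy := trace_young hT hS (p := (1 - α) / z) (div_nonneg (by linarith) hz.le)
      (by rw [div_le_one hz]; exact hz1)
    rw [e] at h
    have hy' := mul_le_mul_of_nonneg_left hy hz.le
    have e3 : z * ((1 - α) / z * T.trace.re + (1 - (1 - α) / z) * S.trace.re) =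
        (1 - α) * T.trace.re + (z - (1 - α)) * S.trace.re := by field_simp
    rw [e3] at hy'
    linarith

lemma mpow_neg_cancel {A : Matrix n n ℂ} (hA : A.PosDef) (s : ℝ) :
    mpow A s * mpow A (-s) = 1 := by
  rw [mpow_add hA, add_neg_cancel, mpow_zero hA]

lemma charpoly_sandwich {K L P Q : Matrix n n ℂ} (h1 : K * L = 1) (h2 : L * K = 1) :
    (K * P * K * (L * Q * L)).charpoly = (P * Q).charpoly := by
  have e : K * P * K * (L * Q * L) = K * (P * (K * L) * Q) * L := by
    simp only [Matrix.mul_assoc]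
  rw [e, h1, Matrix.mul_one, Matrix.charpoly_mul_comm, ← Matrix.mul_assoc, h2, Matrix.one_mul]

lemma traceFun_le_var {α z : ℝ} (hα0 : 0 < α) (hα1 : α < 1) (hz1 : 1 - α ≤ z)
    {ρ σ K L : Matrix n n ℂ} (hρ : ρ.PosDef) (hσ : σ.PosDef) (hK : K.PosDef) (hL : L.PosDef)
    (h1 : K * L = 1) (h2 : L * K = 1) :
    (traceFun α z ρ σ).re ≤
      α * (mpow (K * mpow ρ (α / z) * K) (1 / (α / z))).trace.re +
      (1 - α) * (mpow (L * mpow σ ((1 - α) / z) * L) (1 / ((1 - α) / z))).trace.re := by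
  have hz : 0 < z := by linarith
  have hp : α / z ≠ 0 := by positivity
  have hq : (1 - α) / z ≠ 0 := (div_pos (by linarith) hz).ne'
  have hP := sandwich_posDef hK (mpow_posDef hρ (α / z))
  have hR := sandwich_posDef hL (mpow_posDef hσ ((1 - α) / z))
  have hS := mpow_posDef hP (1 / (α / z))
  have hT := mpow_posDef hR (1 / ((1 - α) / z))
  have hc : (mpow ρ (α / z) * mpow σ ((1 - α) / z)).charpoly =
      (mpow (mpow (K * mpow ρ (α / z) * K) (1 / (α / z))) (α / z) *
        mpow (mpow (L * mpow σ ((1 - α) / z) * L) (1 / ((1 - α) / z))) ((1 - α) / z)).charpoly := by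
    rw [mpow_mpow hP, mpow_mpow hR, one_div_mul_cancel hp, one_div_mul_cancel hq, mpow_one hP,
      mpow_one hR, charpoly_sandwich h1 h2]
  rw [traceFun_congr hρ hσ hS hT hc]
  exact traceFun_le hα0 hα1 hz1 hS hT

set_option maxHeartbeats 2000000 in
lemma traceFun_var_eq {α z : ℝ} (hα0 : 0 < α) (hα1 : α < 1) (hz : 0 < z)
    {ρ σ : Matrix n n ℂ} (hρ : ρ.PosDef) (hσ : σ.PosDef) :
    ∃ H : Matrix n n ℂ, H.PosDef ∧
      α * (mpow (mpow H (1/2) * mpow ρ (α / z) * mpow H (1/2)) (1 / (α / z))).trace.re +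
      (1 - α) * (mpow (mpow H (-(1/2)) * mpow σ ((1 - α) / z) * mpow H (-(1/2)))
        (1 / ((1 - α) / z))).trace.re = (traceFun α z ρ σ).re := by
  have h1α : 0 < 1 - α := by linarith
  unfold traceFun
  set M := mpow ρ (α / (2 * z)) * mpow σ ((1 - α) / z) * mpow ρ (α / (2 * z)) with hM
  have hMpd : M.PosDef := sandwich_posDef (mpow_posDef hρ _) (mpow_posDef hσ _)
  set H := mpow ρ (-(α / (2 * z))) * mpow M α * mpow ρ (-(α / (2 * z))) with hHdef
  have hH : H.PosDef := sandwich_posDef (mpow_posDef hρ _) (mpow_posDef hMpd _)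
  have hr : mpow ρ (-(α / (2 * z))) * mpow ρ (α / (2 * z)) = 1 := by
    have := mpow_neg_cancel hρ (-(α / (2 * z)))
    rwa [neg_neg] at this
  have hr' := mpow_neg_cancel hρ (α / (2 * z))
  have hp2 : mpow ρ (α / z) = mpow ρ (α / (2 * z)) * mpow ρ (α / (2 * z)) := by
    rw [mpow_add hρ]; congr 1; field_simp; ring
  refine ⟨H, hH, ?_⟩
  have t1 : (mpow (mpow H (1/2) * mpow ρ (α / z) * mpow H (1/2)) (1 / (α / z))).trace =
      (mpow M z).trace := by
    have : (mpow (mpow M α) (1 / (α / z))).trace = (mpow M z).trace := by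
      rw [mpow_mpow hMpd]; congr 2; field_simp
    rw [← this]
    refine mpow_trace_eq_of_charpoly (sandwich_posDef (mpow_posDef hH _) (mpow_posDef hρ _)).1
      (mpow_posDef hMpd _).1 ?_ _
    rw [Matrix.charpoly_mul_comm, ← Matrix.mul_assoc, mpow_add hH, add_halves, mpow_one hH, hp2,
      ← Matrix.mul_assoc, Matrix.charpoly_mul_comm]
    congr 1
    have : mpow ρ (α / (2 * z)) * (H * mpow ρ (α / (2 * z))) =
      (mpow ρ (α / (2 * z)) * mpow ρ (-(α / (2 * z)))) * mpow M α *
        (mpow ρ (-(α / (2 * z))) * mpow ρ (α / (2 * z))) := by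
      rw [hHdef]; simp only [Matrix.mul_assoc]
    rw [this, hr, hr']; simp
  have hHinv : mpow H (-1) = mpow ρ (α / (2 * z)) * mpow M (-α) * mpow ρ (α / (2 * z)) := by
    have l1 : mpow H (-1) * H = 1 := by
      have := mpow_neg_cancel hH (-1)
      rwa [neg_neg, mpow_one hH] at this
    have l2 : H * (mpow ρ (α / (2 * z)) * mpow M (-α) * mpow ρ (α / (2 * z))) = 1 := by
      have : H * (mpow ρ (α / (2 * z)) * mpow M (-α) * mpow ρ (α / (2 * z))) =
        mpow ρ (-(α / (2 * z))) * (mpow M α *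
          (mpow ρ (-(α / (2 * z))) * mpow ρ (α / (2 * z))) * mpow M (-α)) *
            mpow ρ (α / (2 * z)) := by
        rw [hHdef]; simp only [Matrix.mul_assoc]
      rw [this, hr, Matrix.mul_one, mpow_neg_cancel hMpd, Matrix.mul_one, hr]
    exact left_inv_eq_right_inv l1 l2
  have t2 : (mpow (mpow H (-(1/2)) * mpow σ ((1 - α) / z) * mpow H (-(1/2)))
      (1 / ((1 - α) / z))).trace = (mpow M z).trace := by
    have : (mpow (mpow M (1 - α)) (1 / ((1 - α) / z))).trace = (mpow M z).trace := by
      rw [mpow_mpow hMpd]; congr 2; field_simp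
    rw [← this]
    refine mpow_trace_eq_of_charpoly (sandwich_posDef (mpow_posDef hH _) (mpow_posDef hσ _)).1
      (mpow_posDef hMpd _).1 ?_ _
    rw [Matrix.charpoly_mul_comm, ← Matrix.mul_assoc, mpow_add hH,
      show -(1/2 : ℝ) + -(1/2) = -1 by norm_num, hHinv, Matrix.mul_assoc, Matrix.mul_assoc,
      Matrix.charpoly_mul_comm, Matrix.mul_assoc, ← hM]
    congr 1
    conv_lhs => enter [2]; rw [← mpow_one hMpd]
    rw [mpow_add hMpd]
    congr 1; ring
  rw [t1, t2]; ring

lemma convex_posDef {A B : Matrix n n ℂ} (hA : A.PosDef) (hB : B.PosDef) {t : ℝ} (ht0 : 0 ≤ t)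
    (ht1 : t ≤ 1) : (t • A + (1 - t) • B).PosDef := by
  rcases ht0.eq_or_lt with h | h
  · subst h; simpa using hB
  · exact (hA.smul h).add_posSemidef (hB.posSemidef.smul (sub_nonneg.2 ht1))

lemma traceFun_one {z : ℝ} (hz : 0 < z) {ρ σ : Matrix n n ℂ} (hρ : ρ.PosDef) (hσ : σ.PosDef) :
    traceFun 1 z ρ σ = ρ.trace := by
  unfold traceFun
  rw [sub_self, zero_div, mpow_zero hσ, Matrix.mul_one, mpow_add hρ, mpow_mpow hρ]
  rw [show (1 / (2 * z) + 1 / (2 * z)) * z = 1 by field_simp; ring, mpow_one hρ]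

end helpers

/-- Joint concavity of the trace functional `f_{α,z}` on pairs of positive definite matrices,
for 0 < α ≤ 1 and z ≥ max(α, 1-α). -/
theorem traceFun_jointly_concave {d : ℕ} (α z : ℝ)
    (hα0 : 0 < α) (hα1 : α ≤ 1) (hz : max α (1 - α) ≤ z)
    (ρ₁ ρ₂ σ₁ σ₂ : Matrix (Fin d) (Fin d) ℂ)
    (hρ₁ : ρ₁.PosDef) (hρ₂ : ρ₂.PosDef) (hσ₁ : σ₁.PosDef) (hσ₂ : σ₂.PosDef)
    (t : ℝ) (ht0 : 0 ≤ t) (ht1 : t ≤ 1) :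
    t * (traceFun α z ρ₁ σ₁).re + (1 - t) * (traceFun α z ρ₂ σ₂).re ≤
      (traceFun α z (t • ρ₁ + (1 - t) • ρ₂) (t • σ₁ + (1 - t) • σ₂)).re := by
  have hz1 : 1 - α ≤ z := (le_max_right _ _).trans hz
  have hz0 : α ≤ z := (le_max_left _ _).trans hz
  have hzpos : 0 < z := by linarith
  have hρ := convex_posDef hρ₁ hρ₂ ht0 ht1
  have hσ := convex_posDef hσ₁ hσ₂ ht0 ht1
  rcases hα1.lt_or_eq with hα1 | rfl
  · obtain ⟨H, hH, hE⟩ := traceFun_var_eq hα0 hα1 hzpos hρ hσ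
    have k1 := mpow_neg_cancel hH (1/2)
    have k2 := mpow_neg_cancel hH (-(1/2))
    rw [neg_neg] at k2
    have l1 := traceFun_le_var hα0 hα1 hz1 hρ₁ hσ₁ (mpow_posDef hH (1/2)) (mpow_posDef hH (-(1/2))) k1 k2
    have l2 := traceFun_le_var hα0 hα1 hz1 hρ₂ hσ₂ (mpow_posDef hH (1/2)) (mpow_posDef hH (-(1/2))) k1 k2
    have e1 := epstein hρ₁ hρ₂ hρ (mpow_posDef hH (1/2)) ht0 ht1 rfl
      (p := α / z) (by positivity) (by rw [div_le_one hzpos]; exact hz0)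
    have e2 := epstein hσ₁ hσ₂ hσ (mpow_posDef hH (-(1/2))) ht0 ht1 rfl
      (p := (1 - α) / z) (div_pos (by linarith) hzpos) (by rw [div_le_one hzpos]; exact hz1)
    have e1' := mul_le_mul_of_nonneg_left e1 hα0.le
    have e2' := mul_le_mul_of_nonneg_left e2 (sub_nonneg.2 hα1.le)
    have l1' := mul_le_mul_of_nonneg_left l1 ht0
    have l2' := mul_le_mul_of_nonneg_left l2 (sub_nonneg.2 ht1)
    rw [← hE]
    linarith
  · rw [traceFun_one hzpos hρ₁ hσ₁, traceFun_one hzpos hρ₂ hσ₂, traceFun_one hzpos hρ hσ]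
    simp
end
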